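/- arXiv:2202.10611 — 4 statements merged into one kernel-verified Lean document; each statement's English description precedes it below -/
import Mathlib

section
/- (de Caen's inequality) Let (Ω, μ) be a probability space and let {A_i}_{i∈I} be a finite family of measurable events with μ(A_i) > 0 for every i ∈ I. Then μ(∪_{i∈I} A_i) ≥ Σ_{i∈I} μ(A_i)² / (Σ_{j∈I} μ(A_i ∩ A_j)). -/
open MeasureTheory

theorem deCaen_pointwise {Ω : Type*} {I : Type*} [Fintype I] (A : I → Set Ω) (t : I → ℝ) (x : Ω) :
    ∑ i, (2 * t i * (A i).indicator (fun _ => (1 : ℝ)) x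
      - t i ^ 2 * ∑ j, (A i ∩ A j).indicator (fun _ => (1 : ℝ)) x)
    ≤ (⋃ i, A i).indicator (fun _ => (1 : ℝ)) x := by
  classical
  set N : ℝ := ∑ j, (A j).indicator (fun _ => (1 : ℝ)) x with hN
  have hmul : ∀ i j, (A i ∩ A j).indicator (fun _ => (1 : ℝ)) x
      = (A i).indicator (fun _ => (1 : ℝ)) x * (A j).indicator (fun _ => (1 : ℝ)) x := by
    intro i j
    by_cases h1 : x ∈ A i <;> by_cases h2 : x ∈ A j <;> simp [h1, h2]
  simp_rw [hmul, ← Finset.mul_sum, ← hN]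
  by_cases hx : x ∈ ⋃ i, A i
  · rw [Set.indicator_of_mem hx]
    obtain ⟨k, hk⟩ := Set.mem_iUnion.1 hx
    have hnn : ∀ i, 0 ≤ (A i).indicator (fun _ => (1 : ℝ)) x := fun i =>
      Set.indicator_nonneg (fun _ _ => zero_le_one) x
    have hNpos : 0 < N := by
      have := Finset.single_le_sum (f := fun j => (A j).indicator (fun _ => (1 : ℝ)) x)
        (fun i _ => hnn i) (Finset.mem_univ k)
      simp only [Set.indicator_of_mem hk] at this
      linarith
    have : ∑ i, (A i).indicator (fun _ => (1 : ℝ)) x * N⁻¹ = 1 := by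
      rw [← Finset.sum_mul, ← hN, mul_inv_cancel₀ hNpos.ne']
    refine le_trans ?_ this.le
    refine Finset.sum_le_sum fun i _ => ?_
    have h : 2 * t i - t i ^ 2 * N ≤ N⁻¹ := by
      have h0 : N⁻¹ - (2 * t i - t i ^ 2 * N) = N⁻¹ * (1 - t i * N) ^ 2 := by
        field_simp
        ring
      have : 0 ≤ N⁻¹ * (1 - t i * N) ^ 2 := by positivity
      linarith
    have := mul_le_mul_of_nonneg_left h (hnn i)
    linarith
  · rw [Set.indicator_of_notMem hx]
    have : ∀ i, x ∉ A i := fun i h => hx (Set.mem_iUnion.2 ⟨i, h⟩)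
    simp [this]

theorem deCaen_real {Ω : Type*} [MeasurableSpace Ω] (μ : Measure Ω)
    [IsProbabilityMeasure μ] {I : Type*} [Fintype I] (A : I → Set Ω)
    (hA : ∀ i, MeasurableSet (A i)) (t : I → ℝ) :
    ∑ i, (2 * t i * μ.real (A i) - t i ^ 2 * ∑ j, μ.real (A i ∩ A j)) ≤ μ.real (⋃ i, A i) := by
  have hint : ∀ S, MeasurableSet S → Integrable (S.indicator (fun _ => (1 : ℝ))) μ :=
    fun S hS => (integrable_const 1).indicator hS
  have hI : ∀ S, MeasurableSet S → ∫ x, S.indicator (fun _ => (1 : ℝ)) x ∂μ = μ.real S := by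
    intro S hS
    rw [integral_indicator hS]; simp
  have h1 : ∀ i, Integrable (fun x => 2 * t i * (A i).indicator (fun _ => (1 : ℝ)) x) μ :=
    fun i => (hint _ (hA i)).const_mul _
  have h2 : ∀ i, Integrable (fun x => ∑ j, (A i ∩ A j).indicator (fun _ => (1 : ℝ)) x) μ :=
    fun i => integrable_finsetSum _ fun j _ => hint _ ((hA i).inter (hA j))
  have h3 : ∀ i, Integrable
      (fun x => t i ^ 2 * ∑ j, (A i ∩ A j).indicator (fun _ => (1 : ℝ)) x) μ :=
    fun i => (h2 i).const_mul _
  have key := integral_mono (μ := μ) (integrable_finsetSum _ fun i _ => (h1 i).sub (h3 i))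
    (hint _ (MeasurableSet.iUnion hA)) (fun x => deCaen_pointwise A t x)
  rw [hI _ (MeasurableSet.iUnion hA)] at key
  refine le_trans (le_of_eq ?_) key
  symm
  refine (integral_finsetSum _ fun i _ => (h1 i).sub (h3 i)).trans ?_
  refine Finset.sum_congr rfl fun i _ => ?_
  refine (integral_sub (h1 i) (h3 i)).trans ?_
  rw [integral_const_mul, integral_const_mul, hI _ (hA i),
    integral_finsetSum _ fun j _ => hint _ ((hA i).inter (hA j))]
  simp_rw [fun j => hI _ ((hA i).inter (hA j))]

/-- de Caen's inequality: for a finite family of events `A i` of positive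
probability, `μ(⋃ i, A i) ≥ ∑ i, μ(A i)² / (∑ j, μ(A i ∩ A j))`. -/
theorem deCaen_inequality {Ω : Type*} [MeasurableSpace Ω] (μ : Measure Ω)
    [IsProbabilityMeasure μ] {I : Type*} [Fintype I] (A : I → Set Ω)
    (hA : ∀ i, MeasurableSet (A i)) (hpos : ∀ i, 0 < μ (A i)) :
    ∑ i, (μ (A i)) ^ 2 / (∑ j, μ (A i ∩ A j)) ≤ μ (⋃ i, A i) := by
  have ha : ∀ i, 0 < μ.real (A i) := fun i =>
    ENNReal.toReal_pos (hpos i).ne' (measure_ne_top _ _)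
  have hs : ∀ i, 0 < ∑ j, μ.real (A i ∩ A j) := by
    intro i
    have := Finset.single_le_sum (f := fun j => μ.real (A i ∩ A j))
      (fun _ _ => measureReal_nonneg) (Finset.mem_univ i)
    simp only [Set.inter_self] at this
    exact (ha i).trans_le this
  have key := deCaen_real μ A hA (fun i => μ.real (A i) / ∑ j, μ.real (A i ∩ A j))
  have e : ∀ S, μ S = ENNReal.ofReal (μ.real S) := fun S => (ofReal_measureReal).symm
  have hterm : ∀ i, (μ (A i)) ^ 2 / (∑ j, μ (A i ∩ A j))
      = ENNReal.ofReal (μ.real (A i) ^ 2 / ∑ j, μ.real (A i ∩ A j)) := by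
    intro i
    rw [ENNReal.ofReal_div_of_pos (hs i), ENNReal.ofReal_pow (ha i).le,
      ENNReal.ofReal_sum_of_nonneg (fun _ _ => measureReal_nonneg)]
    simp_rw [← e]
  simp_rw [hterm]
  rw [← ENNReal.ofReal_sum_of_nonneg (fun i _ => div_nonneg (sq_nonneg _) (hs i).le), e (⋃ i, A i)]
  refine ENNReal.ofReal_le_ofReal (le_trans (le_of_eq ?_) key)
  refine Finset.sum_congr rfl fun i _ => ?_
  have := (hs i).ne'
  field_simp
  ring
end

section
/- Let n, k, t be integers with 1 ≤ k, 2k ≤ n, and 0 ≤ t ≤ k. Then log C(n, k) − log C(n − k, k − t) ≥ t · log((n − k)/k), where C(a, b) denotes the binomial coefficient and log is the natural logarithm. -/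
theorem choose_aux (m j k t : ℕ) (h : j + t ≤ k) :
    m.choose j * m ^ t ≤ k ^ t * (m + t).choose (j + t) := by
  induction t with
  | zero => simp
  | succ t ih =>
    have ih := ih (by omega)
    have e := Nat.add_one_mul_choose_eq (m + t) (j + t)
    calc m.choose j * m ^ (t + 1) = (m.choose j * m ^ t) * m := by ring
      _ ≤ (k ^ t * (m + t).choose (j + t)) * (m + t + 1) :=
          Nat.mul_le_mul ih (by omega)
      _ = k ^ t * ((m + t + 1) * (m + t).choose (j + t)) := by ring
      _ = k ^ t * ((m + t + 1).choose (j + t + 1) * (j + t + 1)) := by rw [e]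
      _ ≤ k ^ t * ((m + t + 1).choose (j + t + 1) * k) := by gcongr; omega
      _ = k ^ (t + 1) * (m + (t + 1)).choose (j + (t + 1)) := by
          rw [← add_assoc, ← add_assoc]; ring

/-- `log C(n, k) − log C(n − k, k − t) ≥ t · log((n − k)/k)` for
`1 ≤ k`, `2k ≤ n`, `0 ≤ t ≤ k`. -/
theorem log_choose_sub_log_choose (n k t : ℕ) (hk : 1 ≤ k) (hn : 2 * k ≤ n) (ht : t ≤ k) :
    (t : ℝ) * Real.log (((n : ℝ) - k) / k) ≤
      Real.log (n.choose k) - Real.log ((n - k).choose (k - t)) := by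
  obtain ⟨m, rfl⟩ : ∃ m, n = m + k := ⟨n - k, by omega⟩
  have h1 := choose_aux m (k - t) k t (by omega)
  rw [Nat.sub_add_cancel ht] at h1
  have h2 : (m + t).choose k ≤ (m + k).choose k := Nat.choose_le_choose k (by omega)
  have h3 := h1.trans (Nat.mul_le_mul_left (k ^ t) h2)
  have hc : 0 < m.choose (k - t) := Nat.choose_pos (by omega)
  have hd : 0 < (m + k).choose k := Nat.choose_pos (by omega)
  have hm : 0 < m := by omega
  have h4 : ((m.choose (k - t) : ℝ)) * (m : ℝ) ^ t ≤ (k : ℝ) ^ t * ((m + k).choose k : ℝ) := by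
    exact_mod_cast h3
  have hc' : (0 : ℝ) < m.choose (k - t) := by exact_mod_cast hc
  have hd' : (0 : ℝ) < (m + k).choose k := by exact_mod_cast hd
  have hm' : (0 : ℝ) < m := by exact_mod_cast hm
  have hk' : (0 : ℝ) < k := by exact_mod_cast hk
  have h5 := Real.log_le_log (by positivity) h4
  rw [Real.log_mul (by positivity) (by positivity), Real.log_mul (by positivity) (by positivity),
    Real.log_pow, Real.log_pow] at h5
  rw [Nat.add_sub_cancel, Nat.cast_add, add_sub_cancel_right,
    Real.log_div (by positivity) (by positivity)]
  linarith
end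

section
/- Let ε ∈ (0, 2/3), let n and k be positive integers with k < n and k ≤ n^(2/3 − ε), and let d > 0 satisfy d^(1+ε) ≥ 4·k^(1.5(1+ε))/n. Define f(β) = βk·log((n − k)/k) − (1 + ε)·k·H₂(β) for β ∈ (0,1), where H₂(p) = p·log(1/p) + (1 − p)·log(1/(1 − p)). Then for every β with d/√k ≤ β < 1, the derivative f'(β) = k·log( ((n − k)/k) · (β/(1 − β))^(1+ε) ) is nonnegative. -/
/-- the function `f(β) = βk·log((n−k)/k) − (1+ε)·k·H₂(β)` has derivative
`f'(β) = k·log(((n−k)/k)·(β/(1−β))^(1+ε))`, which is nonnegative for `d/√k ≤ β < 1`,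
provided `k ≤ n^(2/3−ε)` and `d^(1+ε) ≥ 4·k^(1.5(1+ε))/n`. -/
theorem f_deriv_nonneg (ε : ℝ) (hε1 : 0 < ε) (hε2 : ε < 2/3)
    (n k : ℕ) (hk : 0 < k) (hkn : k < n) (hkn' : (k : ℝ) ≤ (n : ℝ) ^ ((2:ℝ)/3 - ε))
    (d : ℝ) (hd : 0 < d) (hdlb : 4 * (k : ℝ) ^ (1.5 * (1 + ε)) / n ≤ d ^ (1 + ε))
    (β : ℝ) (hβ1 : d / Real.sqrt k ≤ β) (hβ2 : β < 1) :
    HasDerivAt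
      (fun b : ℝ => b * k * Real.log (((n : ℝ) - k) / k) -
        (1 + ε) * k * (b * Real.log (1 / b) + (1 - b) * Real.log (1 / (1 - b))))
      ((k : ℝ) * Real.log ((((n : ℝ) - k) / k) * (β / (1 - β)) ^ (1 + ε))) β ∧
    0 ≤ (k : ℝ) * Real.log ((((n : ℝ) - k) / k) * (β / (1 - β)) ^ (1 + ε)) := by
  have hk0 : (1:ℝ) ≤ k := by exact_mod_cast hk
  have hkp : (0:ℝ) < k := by linarith
  have hkn0 : (k:ℝ) < n := by exact_mod_cast hkn
  have hn : (0:ℝ) < n := by linarith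
  have hs : 0 < Real.sqrt k := Real.sqrt_pos.mpr hkp
  have hβ : 0 < β := lt_of_lt_of_le (div_pos hd hs) hβ1
  have h1β : 0 < 1 - β := by linarith
  have hA : 0 < ((n:ℝ) - k) / k := div_pos (by linarith) hkp
  have hB : 0 < β / (1 - β) := div_pos hβ h1β
  have he : 0 < 1 + ε := by linarith
  constructor
  · have hfun : (fun b : ℝ => b * k * Real.log (((n : ℝ) - k) / k) -
        (1 + ε) * k * (b * Real.log (1 / b) + (1 - b) * Real.log (1 / (1 - b)))) =
        (fun b : ℝ => b * (k * Real.log (((n : ℝ) - k) / k)) +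
        (1 + ε) * k * (b * Real.log b + (1 - b) * Real.log (1 - b))) := by
      funext b
      simp only [one_div, Real.log_inv]
      ring
    rw [hfun, Real.log_mul hA.ne' (Real.rpow_pos_of_pos hB _).ne', Real.log_rpow hB,
      Real.log_div hβ.ne' h1β.ne']
    have h1 := (hasDerivAt_id β).mul_const ((k:ℝ) * Real.log (((n : ℝ) - k) / k))
    have h2 := (hasDerivAt_id β).mul (Real.hasDerivAt_log hβ.ne')
    have h3 : HasDerivAt (fun b : ℝ => 1 - b) (-1) β := by
      simpa using (hasDerivAt_id β).const_sub 1
    have h4 := h3.mul (h3.log h1β.ne')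
    have h5 := h1.add ((h2.add h4).const_mul ((1 + ε) * k))
    refine h5.congr_deriv ?_
    simp only [id]
    field_simp
    ring
  · apply mul_nonneg hkp.le
    apply Real.log_nonneg
    have hb1 : d ^ (1 + ε) ≤ β ^ (1 + ε) * Real.sqrt k ^ (1 + ε) := by
      rw [← Real.mul_rpow hβ.le hs.le]
      exact Real.rpow_le_rpow hd.le ((div_le_iff₀ hs).mp hβ1) he.le
    have hsplit : (k : ℝ) ^ (1.5 * (1 + ε)) = (k:ℝ) ^ (1 + ε) * Real.sqrt k ^ (1 + ε) := by
      rw [Real.sqrt_eq_rpow, ← Real.rpow_mul hkp.le, ← Real.rpow_add hkp]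
      congr 1
      ring
    have hsp : 0 < Real.sqrt k ^ (1 + ε) := Real.rpow_pos_of_pos hs _
    have hkk : (k:ℝ) ≤ (k:ℝ) ^ (1 + ε) := by
      simpa using Real.rpow_le_rpow_of_exponent_le hk0 (show (1:ℝ) ≤ 1 + ε by linarith)
    have h4 : 4 * (k:ℝ) ^ (1 + ε) / n ≤ β ^ (1 + ε) := by
      have := hdlb.trans hb1
      rw [hsplit] at this
      refine le_of_mul_le_mul_right ?_ hsp
      calc _ = 4 * ((k:ℝ) ^ (1 + ε) * Real.sqrt k ^ (1 + ε)) / n := by ring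
        _ ≤ _ := this
    rw [div_le_iff₀ hn] at h4
    have hlt : β ^ (1 + ε) < 1 := Real.rpow_lt_one hβ.le hβ2 he
    have hle : β ^ (1 + ε) ≤ (β / (1 - β)) ^ (1 + ε) := by
      apply Real.rpow_le_rpow hβ.le _ he.le
      rw [le_div_iff₀ h1β]
      nlinarith
    have hx : 0 < β ^ (1 + ε) := Real.rpow_pos_of_pos hβ _
    have h5 : 4 * (k:ℝ) ≤ β ^ (1 + ε) * n := by linarith
    have h6 : 4 * (k:ℝ) < n := by nlinarith
    refine le_trans ?_ (mul_le_mul_of_nonneg_left hle hA.le)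
    rw [div_mul_eq_mul_div, le_div_iff₀ hkp]
    nlinarith
end

section
/- If x, y ∈ ℝ^n are two k-sparse vectors (k ≥ 1) with dynamic range at most R (R ≥ 1), ‖x‖₂ = ‖y‖₂ = 1, and supp(x) ≠ supp(y), then ‖x − y‖₂ ≥ 1/√((k − 1)·R² + 1). -/
theorem sep_aux (n k : ℕ) (R : ℝ) (hR : 1 ≤ R)
    (x y : EuclideanSpace ℝ (Fin n))
    (hxs : (Finset.univ.filter fun i => x i ≠ 0).card ≤ k)
    (hxR : ∀ i j : Fin n, x i ≠ 0 → x j ≠ 0 → |x i| ≤ R * |x j|)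
    (hxn : ‖x‖ = 1) (i : Fin n) (hi : x i ≠ 0) (hyi : y i = 0) :
    1 / Real.sqrt (((k : ℝ) - 1) * R ^ 2 + 1) ≤ ‖x - y‖ := by
  have h1 : |x i| ≤ ‖x - y‖ := by
    have := PiLp.norm_apply_le (x - y) i
    simpa [hyi] using this
  refine le_trans ?_ h1
  have hmem : i ∈ Finset.univ.filter fun i => x i ≠ 0 := by simp [hi]
  have hsum : (1 : ℝ) = ∑ j ∈ Finset.univ.filter (fun i => x i ≠ 0), (x j) ^ 2 := by
    have h := EuclideanSpace.real_norm_sq_eq x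
    rw [hxn] at h
    rw [Finset.sum_filter_of_ne]
    · simpa using h
    · intro j _ hj h0
      simp [h0] at hj
  rw [← Finset.add_sum_erase _ _ hmem] at hsum
  have hb : ∑ j ∈ (Finset.univ.filter (fun i => x i ≠ 0)).erase i, (x j) ^ 2
      ≤ ((Finset.univ.filter (fun i => x i ≠ 0)).erase i).card • (R ^ 2 * (x i) ^ 2) := by
    apply Finset.sum_le_card_nsmul
    intro j hj
    have hj' : x j ≠ 0 := by simpa using (Finset.mem_filter.mp (Finset.mem_of_mem_erase hj)).2
    have h := pow_le_pow_left₀ (abs_nonneg _) (hxR j i hj' hi) 2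
    rwa [mul_pow, sq_abs, sq_abs] at h
  have hc : (((Finset.univ.filter (fun i => x i ≠ 0)).erase i).card : ℝ) ≤ (k : ℝ) - 1 := by
    have h := Finset.card_erase_add_one hmem
    have h2 : ((Finset.univ.filter (fun i => x i ≠ 0)).erase i).card + 1 ≤ k := by omega
    have h3 : (((Finset.univ.filter (fun i => x i ≠ 0)).erase i).card : ℝ) + 1 ≤ k := by
      exact_mod_cast h2
    linarith
  rw [nsmul_eq_mul] at hb
  have hb2 := mul_le_mul_of_nonneg_right hc (by positivity : 0 ≤ R ^ 2 * (x i) ^ 2)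
  have hk0 : 0 ≤ (k : ℝ) - 1 := le_trans (Nat.cast_nonneg _) hc
  have hD : 0 < ((k : ℝ) - 1) * R ^ 2 + 1 := by positivity
  rw [div_le_iff₀ (Real.sqrt_pos.mpr hD), ← Real.sqrt_sq_eq_abs, ← Real.sqrt_mul (sq_nonneg _),
    Real.one_le_sqrt]
  linarith

/-- two unit-norm `k`-sparse vectors with dynamic range at most `R` and
different supports are at Euclidean distance at least `1/√((k−1)R² + 1)`. -/
theorem sep_of_diff_support (n k : ℕ) (hk : 1 ≤ k) (R : ℝ) (hR : 1 ≤ R)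
    (x y : EuclideanSpace ℝ (Fin n))
    (hxs : (Finset.univ.filter fun i => x i ≠ 0).card ≤ k)
    (hys : (Finset.univ.filter fun i => y i ≠ 0).card ≤ k)
    (hxR : ∀ i j : Fin n, x i ≠ 0 → x j ≠ 0 → |x i| ≤ R * |x j|)
    (hyR : ∀ i j : Fin n, y i ≠ 0 → y j ≠ 0 → |y i| ≤ R * |y j|)
    (hxn : ‖x‖ = 1) (hyn : ‖y‖ = 1)
    (hsupp : Function.support x ≠ Function.support y) :
    1 / Real.sqrt (((k : ℝ) - 1) * R ^ 2 + 1) ≤ ‖x - y‖ := by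
  by_contra hcon
  apply hsupp
  ext i
  simp only [Function.mem_support]
  constructor
  · intro hi hy
    exact hcon (sep_aux n k R hR x y hxs hxR hxn i hi hy)
  · intro hi hx
    rw [norm_sub_rev] at hcon
    exact hcon (sep_aux n k R hR y x hys hyR hyn i hi hx)
end
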